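/- arXiv:1009.5021 — 4 statements merged into one kernel-verified Lean document; each statement's English description precedes it below -/
import Mathlib

section
/- Let E be a complete separable metric space and let φ : [0,∞) × E → E be a semi-flow (φ_0 = id, φ_{s+t} = φ_s ∘ φ_t for all s,t ≥ 0) such that for every t ≥ 0 the map y ↦ φ_t(y) is continuous. Suppose φ is reversible under a Borel probability measure Π on E, i.e. for every t ≥ 0 the pushforward of Π under y ↦ (y, φ_t(y)) equals the pushforward of Π under y ↦ (φ_t(y), y) (as measures on E × E). Then Π is concentrated on the set S of stationary points of φ, i.e. Π({y ∈ E : φ_t(y) = y for all t ≥ 0}) = 1. -/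
open MeasureTheory

/-- A space-continuous semi-flow that is reversible under a Borel probability measure
is concentrated on its set of stationary points. -/
theorem reversible_semiflow_concentrated_on_stationary_points
    {E : Type*} [MetricSpace E] [CompleteSpace E] [TopologicalSpace.SeparableSpace E]
    [MeasurableSpace E] [BorelSpace E]
    (φ : ℝ → E → E)
    (hφ0 : ∀ y, φ 0 y = y)
    (hφadd : ∀ s t : ℝ, 0 ≤ s → 0 ≤ t → ∀ y, φ (s + t) y = φ s (φ t y))
    (hφcont : ∀ t : ℝ, 0 ≤ t → Continuous (φ t))
    (P : Measure E) [IsProbabilityMeasure P]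
    (hrev : ∀ t : ℝ, 0 ≤ t →
      Measure.map (fun y => (y, φ t y)) P = Measure.map (fun y => (φ t y, y)) P) :
    P {y : E | ∀ t : ℝ, 0 ≤ t → φ t y = y} = 1 := by
  have : SecondCountableTopology E := UniformSpace.secondCountable_of_separable E
  have key : ∀ t : ℝ, 0 ≤ t → ∀ᵐ y ∂P, φ t y = y := by
    intro t ht
    have h2 : 0 ≤ t / 2 := by linarith
    have hc := hφcont _ h2
    have hS : MeasurableSet {p : E × E | φ (t / 2) p.1 = p.2} :=
      (isClosed_eq (hc.comp continuous_fst) continuous_snd).measurableSet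
    have h1 : ∀ᵐ p ∂(Measure.map (fun y => (y, φ (t / 2) y)) P), φ (t / 2) p.1 = p.2 := by
      rw [ae_map_iff (continuous_id'.prodMk hc).measurable.aemeasurable hS]
      exact Filter.Eventually.of_forall fun y => rfl
    rw [hrev _ h2, ae_map_iff (hc.prodMk continuous_id').measurable.aemeasurable hS] at h1
    filter_upwards [h1] with y hy
    have := hφadd _ _ h2 h2 y
    rw [add_halves] at this
    exact this.trans hy
  have hsub : P.support ⊆ {y : E | ∀ t : ℝ, 0 ≤ t → φ t y = y} := fun y hy t ht =>
    Measure.support_subset_of_isClosed (isClosed_eq (hφcont t ht) continuous_id) (key t ht) hy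
  have hae : ∀ᵐ y ∂P, y ∈ {y : E | ∀ t : ℝ, 0 ≤ t → φ t y = y} :=
    Filter.mem_of_superset Measure.support_mem_ae hsub
  exact (measure_congr (Filter.eventuallyEq_univ.2 hae)).trans measure_univ
end

section
/- Let E be a complete separable metric space with metric d, let φ : [0,∞) × E → E be a semi-flow such that y ↦ φ_t(y) is continuous for each t ≥ 0, and let Π be a Borel probability measure on E under which φ is reversible. Then for every point y₀ ∈ E that is not a stationary point of φ (i.e. φ_t(y₀) ≠ y₀ for some t ≥ 0), there exists α > 0 such that Π(B(y₀, α)) = 0, where B(y₀, α) = {x ∈ E : d(x, y₀) < α} is the open ball of radius α around y₀. -/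
open MeasureTheory

/-- If a space-continuous semi-flow is reversible under a Borel probability measure `P`,
then every non-stationary point has a ball around it of `P`-measure zero. -/
theorem nonstationary_point_has_null_ball
    {E : Type*} [MetricSpace E] [CompleteSpace E] [TopologicalSpace.SeparableSpace E]
    [MeasurableSpace E] [BorelSpace E]
    (φ : ℝ → E → E)
    (hφ0 : ∀ y, φ 0 y = y)
    (hφadd : ∀ s t : ℝ, 0 ≤ s → 0 ≤ t → ∀ y, φ (s + t) y = φ s (φ t y))
    (hφcont : ∀ t : ℝ, 0 ≤ t → Continuous (φ t))
    (P : Measure E) [IsProbabilityMeasure P]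
    (hrev : ∀ t : ℝ, 0 ≤ t →
      Measure.map (fun y => (y, φ t y)) P = Measure.map (fun y => (φ t y, y)) P)
    (y₀ : E) (hy₀ : ∃ t : ℝ, 0 ≤ t ∧ φ t y₀ ≠ y₀) :
    ∃ α : ℝ, 0 < α ∧ P (Metric.ball y₀ α) = 0 := by
  obtain ⟨t, ht, hne⟩ := hy₀
  have : SecondCountableTopology E := UniformSpace.secondCountable_of_separable E
  have hs : 0 ≤ t / 2 := by positivity
  have hc := hφcont _ hs
  have hm : MeasurableSet {p : E × E | φ (t / 2) p.1 ≠ p.2} :=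
    (isOpen_ne_fun (hc.comp continuous_fst) continuous_snd).measurableSet
  have h := congrArg (fun μ => μ {p : E × E | φ (t / 2) p.1 ≠ p.2}) (hrev _ hs)
  rw [Measure.map_apply (continuous_id'.prodMk hc).measurable hm,
    Measure.map_apply (hc.prodMk continuous_id').measurable hm] at h
  have h0 : P {y | φ t y ≠ y} = 0 := by
    have e : ∀ y, φ t y = φ (t / 2) (φ (t / 2) y) := fun y => by
      rw [← hφadd _ _ hs hs, add_halves]
    simp only [e]
    simpa using h.symm
  obtain ⟨α, hα, hsub⟩ := Metric.isOpen_iff.1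
    (isOpen_ne_fun (hφcont t ht) continuous_id) y₀ hne
  exact ⟨α, hα, measure_mono_null hsub h0⟩
end

section
/- Let E be a complete separable metric space and let φ : [0,∞) × E → E be a semi-flow such that y ↦ φ_t(y) is continuous for each t ≥ 0. If φ has no stationary points (i.e. for every y ∈ E there exists t ≥ 0 with φ_t(y) ≠ y), then there is no Borel probability measure Π on E under which φ is reversible. -/
open MeasureTheory

/-- A space-continuous semi-flow without any stationary point cannot be reversible
under any Borel probability measure. -/
theorem no_stationary_point_implies_no_reversible_measure
    {E : Type*} [MetricSpace E] [CompleteSpace E] [TopologicalSpace.SeparableSpace E]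
    [MeasurableSpace E] [BorelSpace E]
    (φ : ℝ → E → E)
    (hφ0 : ∀ y, φ 0 y = y)
    (hφadd : ∀ s t : ℝ, 0 ≤ s → 0 ≤ t → ∀ y, φ (s + t) y = φ s (φ t y))
    (hφcont : ∀ t : ℝ, 0 ≤ t → Continuous (φ t))
    (hnostat : ∀ y : E, ∃ t : ℝ, 0 ≤ t ∧ φ t y ≠ y) :
    ¬ ∃ P : Measure E, IsProbabilityMeasure P ∧
      ∀ t : ℝ, 0 ≤ t →
        Measure.map (fun y => (y, φ t y)) P = Measure.map (fun y => (φ t y, y)) P := by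
  rintro ⟨P, hP, hrev⟩
  have : SecondCountableTopology E := UniformSpace.secondCountable_of_separable E
  have key : ∀ t : ℝ, 0 ≤ t → P {y | φ t y ≠ y} = 0 := by
    intro t ht
    have h2 : 0 ≤ t / 2 := by linarith
    have hc := hφcont (t / 2) h2
    have hS : MeasurableSet {p : E × E | p.2 ≠ φ (t / 2) p.1} :=
      (isOpen_ne_fun continuous_snd (hc.comp continuous_fst)).measurableSet
    have h := congrArg (fun μ => μ {p : E × E | p.2 ≠ φ (t / 2) p.1}) (hrev (t / 2) h2)
    rw [Measure.map_apply (continuous_id'.prodMk hc).measurable hS,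
      Measure.map_apply (hc.prodMk continuous_id').measurable hS] at h
    have e1 : (fun y => (y, φ (t / 2) y)) ⁻¹' {p : E × E | p.2 ≠ φ (t / 2) p.1} = ∅ := by
      ext y; simp
    have e2 : (fun y => (φ (t / 2) y, y)) ⁻¹' {p : E × E | p.2 ≠ φ (t / 2) p.1}
        = {y | φ t y ≠ y} := by
      ext y
      have := hφadd (t / 2) (t / 2) h2 h2 y
      rw [add_halves] at this
      simp only [Set.mem_preimage, Set.mem_setOf_eq, this]
      exact ne_comm
    rw [e1, e2, measure_empty] at h
    exact h.symm
  obtain ⟨y, -, hy⟩ := exists_mem_forall_mem_nhdsWithin_pos_measure (μ := P) (s := Set.univ)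
    (by simp)
  obtain ⟨t, ht, hne⟩ := hnostat y
  have hopen : IsOpen {y | φ t y ≠ y} := isOpen_ne_fun (hφcont t ht) continuous_id
  have := hy {y | φ t y ≠ y} (by rw [nhdsWithin_univ]; exact hopen.mem_nhds hne)
  rw [key t ht] at this
  exact lt_irrefl _ this
end

section
/- Fix s > 0 and define, for N ∈ ℕ with N > s, a_N(s) := max( s/N , |(N−1)·log(1 − s/N) + s| ). Then: (1) for every N > s and every y ∈ [0, 1] such that N·y is an integer (so y = 0 or y ∈ [1/N, 1]), one has | y·(1 − s/N)^{N y − 1} − y·e^{−s y} | ≤ a_N(s); and (2) a_N(s) → 0 as N → ∞. Consequently, if Q is an I × I stochastic matrix and V^N(y) := Σ_{i,j} y_i (1 − s/N)^{N y_i − 1} Q_{i,j} (−e_i + e_j) and V(y) := Σ_{i,j} y_i e^{−s y_i} Q_{i,j} (−e_i + e_j) for y in the simplex Δ_I = {y ∈ ℝ^I : y_i ≥ 0, Σ_i y_i = 1}, then sup over y ∈ Δ_I with N y ∈ ℕ^I of ‖V^N(y) − V(y)‖ tends to 0 as N → ∞ (for any norm on ℝ^I). -/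
open Filter

lemma abs_exp_sub_le {u v : ℝ} (hu : u ≤ 0) (hv : v ≤ 0) :
    |Real.exp u - Real.exp v| ≤ |u - v| := by
  wlog h : v ≤ u generalizing u v
  · rw [abs_sub_comm, abs_sub_comm u v]
    exact this hv hu (le_of_not_ge h)
  have h1 : Real.exp v ≤ Real.exp u := Real.exp_le_exp.2 h
  rw [abs_of_nonneg (by linarith), abs_of_nonneg (by linarith)]
  have h2 : Real.exp v = Real.exp u * Real.exp (v - u) := by
    rw [← Real.exp_add]; congr 1; ring
  have h3 := Real.add_one_le_exp (v - u)
  have h4 : Real.exp u ≤ 1 := Real.exp_le_one_iff.2 hu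
  have h5 := Real.exp_pos u
  rw [h2]
  nlinarith

lemma crowd_part1 (s : ℝ) (hs : 0 < s) (N : ℕ) (hN : s < N) (y : ℝ) (hy0 : 0 ≤ y) (hy1 : y ≤ 1)
    (hm : ∃ m : ℕ, (m : ℝ) = N * y) :
    |y * (1 - s / N) ^ ((N : ℝ) * y - 1) - y * Real.exp (-s * y)| ≤
      max (s / N) |((N : ℝ) - 1) * Real.log (1 - s / N) + s| := by
  obtain ⟨m, hm⟩ := hm
  have hNpos : (0 : ℝ) < N := hs.trans hN
  have hsN : 0 < s / N := by positivity
  have hsN1 : s / N < 1 := (div_lt_one hNpos).2 hN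
  have hN1 : (1 : ℝ) ≤ N := by
    have : 0 < N := by exact_mod_cast hNpos
    exact_mod_cast this
  set M := max (s / N) |((N : ℝ) - 1) * Real.log (1 - s / N) + s| with hM
  have hM1 : s / N ≤ M := le_max_left _ _
  have hM2 : |((N : ℝ) - 1) * Real.log (1 - s / N) + s| ≤ M := le_max_right _ _
  have hMpos : 0 < M := hsN.trans_le hM1
  rcases Nat.eq_zero_or_pos m with h0 | h0
  · have : y = 0 := by
      subst h0
      have h : (N : ℝ) * y = 0 := by rw [← hm]; simp
      rcases mul_eq_zero.1 h with h | h
      · linarith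
      · exact h
    subst this
    simpa using hMpos.le
  have hNy : (1 : ℝ) ≤ N * y := by
    rw [← hm]; exact_mod_cast h0
  rw [← mul_sub, abs_mul, abs_of_nonneg hy0, Real.rpow_def_of_pos (by linarith)]
  have hL : Real.log (1 - s / N) ≤ 0 := Real.log_nonpos (by linarith) (by linarith)
  have hexp := abs_exp_sub_le (u := Real.log (1 - s / N) * (N * y - 1)) (v := -s * y)
    (mul_nonpos_of_nonpos_of_nonneg hL (by linarith)) (by nlinarith)
  have key : |Real.log (1 - s / N) * (N * y - 1) - -s * y| ≤ M := by
    generalize Real.log (1 - s / N) = L at *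
    rcases eq_or_lt_of_le hN1 with h1 | h1
    · have : y = 1 := by
        rw [← h1] at hNy; linarith
      subst this
      convert hM2 using 2
      ring
    · have hid : ((N : ℝ) - 1) * (L * (N * y - 1) - -s * y) =
          (N * y - 1) * (((N : ℝ) - 1) * L + s) + (N - N * y) * (s / N) := by
        field_simp; ring
      have hB := abs_le.1 hM2
      have hNy2 : 0 ≤ N - N * y := by nlinarith
      have hNy3 : 0 ≤ N * y - 1 := by linarith
      have hpos : 0 < (N : ℝ) - 1 := by linarith
      rw [abs_le]
      constructor
      · refine le_of_mul_le_mul_left ?_ hpos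
        rw [hid]
        have e1 := mul_le_mul_of_nonneg_left hB.1 hNy3
        have e2 := mul_le_mul_of_nonneg_left (show -M ≤ s / N by linarith) hNy2
        linarith
      · refine le_of_mul_le_mul_left ?_ hpos
        rw [hid]
        have e1 := mul_le_mul_of_nonneg_left hB.2 hNy3
        have e2 := mul_le_mul_of_nonneg_left hM1 hNy2
        linarith
  have h6 := hexp.trans key
  have h7 := mul_le_mul_of_nonneg_right hy1
    (abs_nonneg (Real.exp (Real.log (1 - s / N) * (N * y - 1)) - Real.exp (-s * y)))
  linarith

lemma crowd_part2 (s : ℝ) :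
    Tendsto (fun N : ℕ => max (s / N) |((N : ℝ) - 1) * Real.log (1 - s / N) + s|) atTop
      (nhds 0) := by
  have h1 : Tendsto (fun N : ℕ => s / (N : ℝ)) atTop (nhds 0) :=
    tendsto_const_div_atTop_nhds_zero_nat s
  have h2 : Tendsto (fun N : ℕ => (N : ℝ) * Real.log (1 + (-s) / N)) atTop (nhds (-s)) :=
    (Real.tendsto_mul_log_one_add_div_atTop (-s)).comp tendsto_natCast_atTop_atTop
  have h3 : Tendsto (fun N : ℕ => Real.log (1 - s / (N : ℝ))) atTop (nhds (Real.log (1 - 0))) :=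
    (tendsto_const_nhds.sub h1).log (by norm_num)
  have h4 := ((h2.sub h3).add_const s).abs
  have h5 := h1.max h4
  convert h5 using 2
  · congr 2
    rw [neg_div, ← sub_eq_add_neg]; ring
  · simp

/-- The error bound `a_N(s)` controls the difference between the pre-limit drift term
`y (1-s/N)^{Ny-1}` and its limit `y e^{-sy}` uniformly on the feasible states, it tends
to `0`, and hence the drift `V^N` converges to `V` uniformly on the feasible states of
the simplex. -/
theorem crowd_dynamics_drift_uniform_convergence
    (s : ℝ) (hs : 0 < s)
    (a : ℕ → ℝ)
    (ha : ∀ N : ℕ, a N =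
      max (s / N) |((N : ℝ) - 1) * Real.log (1 - s / N) + s|) :
    (∀ N : ℕ, s < N → ∀ y : ℝ, 0 ≤ y → y ≤ 1 → (∃ m : ℕ, (m : ℝ) = N * y) →
      |y * (1 - s / N) ^ ((N : ℝ) * y - 1) - y * Real.exp (-s * y)| ≤ a N) ∧
    Tendsto a atTop (nhds 0) ∧
    (∀ (I : ℕ) (Q : Matrix (Fin I) (Fin I) ℝ),
      (∀ i j, 0 ≤ Q i j) → (∀ i, ∑ j, Q i j = 1) →
      ∀ ε : ℝ, 0 < ε → ∃ N₀ : ℕ, ∀ N : ℕ, N₀ ≤ N → s < N →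
        ∀ y : Fin I → ℝ, (∀ i, 0 ≤ y i) → (∑ i, y i = 1) →
          (∀ i, ∃ m : ℕ, (m : ℝ) = N * y i) →
          ‖(∑ i, ∑ j, (y i * (1 - s / N) ^ ((N : ℝ) * y i - 1) * Q i j) •
              (Pi.single j 1 - Pi.single i 1) : Fin I → ℝ) -
            (∑ i, ∑ j, (y i * Real.exp (-s * y i) * Q i j) •
              (Pi.single j 1 - Pi.single i 1) : Fin I → ℝ)‖ ≤ ε) := by
  obtain rfl : a = _ := funext ha
  refine ⟨fun N hN y h0 h1 hm => crowd_part1 s hs N hN y h0 h1 hm, crowd_part2 s, ?_⟩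
  intro I Q hQ hQ1 ε hε
  have hδ : 0 < ε / (2 * I + 1) := by positivity
  obtain ⟨N₀, hN₀⟩ := eventually_atTop.1 ((crowd_part2 s).eventually_lt_const hδ)
  refine ⟨N₀, fun N hN hsN y hy0 hy1 hm => ?_⟩
  have hMlt := hN₀ N hN
  set M := max (s / N) |((N : ℝ) - 1) * Real.log (1 - s / N) + s| with hM
  have hb : ∀ i, |y i * (1 - s / N) ^ ((N : ℝ) * y i - 1) - y i * Real.exp (-s * y i)| ≤ M :=
    fun i => crowd_part1 s hs N hsN (y i) (hy0 i)
      (hy1 ▸ Finset.single_le_sum (fun j _ => hy0 j) (Finset.mem_univ i)) (hm i)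
  have hM0 : 0 ≤ M := (abs_nonneg _).trans (le_max_right _ _)
  rw [← Finset.sum_sub_distrib]
  simp_rw [← Finset.sum_sub_distrib, ← sub_smul, ← sub_mul]
  have hsing : ∀ i : Fin I, ‖(Pi.single i 1 : Fin I → ℝ)‖ ≤ 1 := by
    intro i
    refine (pi_norm_le_iff_of_nonneg zero_le_one).2 fun k => ?_
    by_cases h : k = i
    · subst h; simp
    · simp [h]
  calc _ ≤ ∑ i : Fin I, ∑ j : Fin I, M * Q i j * 2 := by
        refine norm_sum_le_of_le _ fun i _ => norm_sum_le_of_le _ fun j _ => ?_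
        rw [norm_smul, Real.norm_eq_abs, abs_mul, abs_of_nonneg (hQ i j)]
        refine mul_le_mul (mul_le_mul_of_nonneg_right (hb i) (hQ i j)) ?_ (norm_nonneg _)
          (mul_nonneg hM0 (hQ i j))
        have := norm_sub_le (Pi.single j 1 : Fin I → ℝ) (Pi.single i 1)
        linarith [hsing i, hsing j]
    _ = M * (2 * I) := by
        simp_rw [← Finset.sum_mul, ← Finset.mul_sum, hQ1]
        simp; ring
    _ ≤ M * (2 * I + 1) := by nlinarith
    _ ≤ ε := by
        rw [lt_div_iff₀ (by positivity)] at hMlt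
        exact hMlt.le
end
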